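/- For every real a > 0 and real b, and for real x → ∞, the function G(x; a, b) = Γ(b+ix, a)/a^{b+ix} + Γ(b−ix, a)/a^{b−ix} satisfies G(x; a, b) = (2(a−b)/e^a)·x^{−2} + O(x^{−4}). -/

import Mathlib

open MeasureTheory Complex Filter

/-- Upper incomplete gamma function `Γ(s, a) = ∫ₐ^∞ e^{−t} t^{s−1} dt`. -/
noncomputable def incGamma (s : ℂ) (a : ℝ) : ℂ :=
  ∫ t in Set.Ioi a, Real.exp (-t) * (t : ℂ) ^ (s - 1)

/-- The hyperbolic gamma function `G(z; a, b)`. -/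
noncomputable def hypGamma (z : ℂ) (a b : ℝ) : ℂ :=
  incGamma ((b : ℂ) + Complex.I * z) a / (a : ℂ) ^ ((b : ℂ) + Complex.I * z) +
  incGamma ((b : ℂ) - Complex.I * z) a / (a : ℂ) ^ ((b : ℂ) - Complex.I * z)

theorem integrableOn_exp_neg_mul_rpow_Ioi {a : ℝ} (ha : 0 < a) (r : ℝ) :
    IntegrableOn (fun t : ℝ => Real.exp (-t) * t ^ r) (Set.Ioi a) := by
  refine integrable_of_isBigO_exp_neg (b := 1 / 2) (by norm_num) ?_ ?_
  · refine ContinuousOn.mul (by fun_prop) ?_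
    exact continuousOn_id.rpow_const fun t ht => Or.inl (ha.trans_le ht).ne'
  · have h := (isLittleO_rpow_exp_pos_mul_atTop r (b := 1 / 2) (by norm_num)).isBigO
    refine ((Asymptotics.isBigO_refl (fun t : ℝ => Real.exp (-t)) atTop).mul h).congr_right ?_
    intro t
    rw [← Real.exp_add]
    ring_nf

theorem norm_exp_neg_mul_cpow {t : ℝ} (ht : 0 < t) (s : ℂ) :
    ‖((Real.exp (-t) : ℝ) : ℂ) * (t : ℂ) ^ s‖ = Real.exp (-t) * t ^ s.re := by
  rw [norm_mul, Complex.norm_of_nonneg (Real.exp_pos _).le,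
    Complex.norm_cpow_eq_rpow_re_of_pos ht]

theorem integrableOn_exp_neg_mul_cpow_Ioi {a : ℝ} (ha : 0 < a) (s : ℂ) :
    IntegrableOn (fun t : ℝ => ((Real.exp (-t) : ℝ) : ℂ) * (t : ℂ) ^ s) (Set.Ioi a) := by
  refine (integrableOn_exp_neg_mul_rpow_Ioi ha s.re).mono' ?_ ?_
  · refine ContinuousOn.aestronglyMeasurable (fun t ht => ?_) measurableSet_Ioi
    refine ContinuousAt.continuousWithinAt (ContinuousAt.mul (by fun_prop) ?_)
    exact Complex.continuousAt_ofReal_cpow_const t s (Or.inr (ha.trans ht).ne')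
  · filter_upwards [ae_restrict_mem measurableSet_Ioi] with t ht
    exact (norm_exp_neg_mul_cpow (ha.trans ht) s).le

/-- The functional equation of the upper incomplete gamma function. -/
theorem incGamma_add_one {a : ℝ} (ha : 0 < a) (s : ℂ) :
    incGamma (s + 1) a = s * incGamma s a + (a : ℂ) ^ s * (Real.exp (-a) : ℝ) := by
  have hderiv : ∀ t ∈ Set.Ici a, HasDerivAt
      (fun t : ℝ => ((Real.exp (-t) : ℝ) : ℂ) * (t : ℂ) ^ s)
      (s * (((Real.exp (-t) : ℝ) : ℂ) * (t : ℂ) ^ (s - 1))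
        - ((Real.exp (-t) : ℝ) : ℂ) * (t : ℂ) ^ s) t := by
    intro t ht
    have ht0 : 0 < t := ha.trans_le ht
    have h1 : HasDerivAt (fun t : ℝ => ((Real.exp (-t) : ℝ) : ℂ))
        ((Real.exp (-t) * -1 : ℝ) : ℂ) t := (hasDerivAt_neg t).exp.ofReal_comp
    have h2 : HasDerivAt (fun t : ℝ => (t : ℂ) ^ s) (s * (t : ℂ) ^ (s - 1) * 1) t :=
      ((hasDerivAt_id (t : ℂ)).cpow_const (Complex.ofReal_mem_slitPlane.mpr ht0)).comp_ofReal
    refine (h1.mul h2).congr_deriv ?_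
    push_cast
    ring
  have hI := (integrableOn_exp_neg_mul_cpow_Ioi ha (s - 1)).const_mul s
  have hJ := integrableOn_exp_neg_mul_cpow_Ioi ha s
  have hlim : Tendsto (fun t : ℝ => ((Real.exp (-t) : ℝ) : ℂ) * (t : ℂ) ^ s) atTop (nhds 0) :=
    tendsto_zero_of_hasDerivAt_of_integrableOn_Ioi
      (fun t ht => hderiv t (Set.mem_Ici_of_Ioi ht)) (hI.sub hJ) hJ
  have key := integral_Ioi_of_hasDerivAt_of_tendsto' hderiv (hI.sub hJ) hlim
  rw [integral_sub hI hJ, integral_const_mul] at key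
  simp only [incGamma, add_sub_cancel_right]
  linear_combination -key

/-- `incGamma s a` normalised by `a ^ s`. -/
noncomputable def scaledIncGamma (a : ℝ) (s : ℂ) : ℂ := incGamma s a / (a : ℂ) ^ s

theorem mul_scaledIncGamma {a : ℝ} (ha : 0 < a) (s : ℂ) :
    s * scaledIncGamma a s = a * scaledIncGamma a (s + 1) - (Real.exp (-a) : ℝ) := by
  have ha' : (a : ℂ) ≠ 0 := Complex.ofReal_ne_zero.mpr ha.ne'
  have hs : (a : ℂ) ^ s ≠ 0 := by simp [Complex.cpow_eq_zero_iff, ha']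
  rw [scaledIncGamma, scaledIncGamma, incGamma_add_one ha, Complex.cpow_add _ _ ha',
    Complex.cpow_one]
  field_simp
  ring

theorem norm_scaledIncGamma_le {a : ℝ} (ha : 0 < a) (s : ℂ) :
    ‖scaledIncGamma a s‖ ≤
      (∫ t in Set.Ioi a, Real.exp (-t) * t ^ (s.re - 1)) / a ^ s.re := by
  rw [scaledIncGamma, norm_div, Complex.norm_cpow_eq_rpow_re_of_pos ha]
  refine div_le_div_of_nonneg_right ?_ (Real.rpow_nonneg ha.le _)
  refine (norm_integral_le_integral_norm _).trans_eq ?_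
  refine setIntegral_congr_fun measurableSet_Ioi fun t ht => ?_
  simpa using norm_exp_neg_mul_cpow (ha.trans ht) (s - 1)

theorem isBigO_one_scaledIncGamma {a : ℝ} (ha : 0 < a) (b : ℝ) {w : ℝ → ℂ}
    (hre : ∀ x, (w x).re = 0) :
    (fun x => scaledIncGamma a (b + w x)) =O[atTop] fun x : ℝ => x⁻¹ ^ 0 := by
  refine Asymptotics.IsBigO.of_bound
    ((∫ t in Set.Ioi a, Real.exp (-t) * t ^ (b - 1)) / a ^ b) (Eventually.of_forall fun x => ?_)
  simpa [hre] using norm_scaledIncGamma_le ha (b + w x)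

/-- One step of the asymptotic expansion, from the functional equation solved for the term
carrying the large factor `w`. -/
theorem scaledIncGamma_expansion_succ {a : ℝ} (ha : 0 < a) {w : ℝ → ℂ}
    (hw : ∀ x, ‖w x‖ = |x|) {p : ℝ → ℝ → ℂ} {n : ℕ}
    (hp : ∀ b : ℝ, (fun x => scaledIncGamma a (b + w x) - p b x) =O[atTop] fun x : ℝ => x⁻¹ ^ n)
    (b : ℝ) :
    (fun x => scaledIncGamma a (b + w x)
      - (-(Real.exp (-a) : ℝ) - b * p b x + a * p (b + 1) x) / w x)
      =O[atTop] fun x : ℝ => x⁻¹ ^ (n + 1) := by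
  have hinv : (fun x => (w x)⁻¹) =O[atTop] fun x : ℝ => x⁻¹ :=
    Asymptotics.IsBigO.of_bound 1 (Eventually.of_forall fun x => by simp [hw])
  have h := (((hp (b + 1)).const_mul_left (a : ℂ)).sub ((hp b).const_mul_left (b : ℂ))).mul hinv
  refine h.congr' ?_ (Eventually.of_forall fun x => (pow_succ _ _).symm)
  filter_upwards [eventually_gt_atTop 0] with x hx
  have hw0 : w x ≠ 0 := by
    rw [← norm_ne_zero_iff, hw]
    exact abs_ne_zero.mpr hx.ne'
  have hrec := mul_scaledIncGamma ha (b + w x)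
  have hshift : ((b + 1 : ℝ) : ℂ) + w x = b + w x + 1 := by push_cast; ring
  rw [hshift]
  field_simp
  linear_combination -hrec

theorem scaledIncGamma_expansion {a : ℝ} (ha : 0 < a) (b : ℝ) {w : ℝ → ℂ}
    (hre : ∀ x, (w x).re = 0) (hw : ∀ x, ‖w x‖ = |x|) :
    (fun x => scaledIncGamma a (b + w x) - (Real.exp (-a) : ℝ) *
      (-(w x)⁻¹ + (b - a) * (w x)⁻¹ ^ 2 + (a * (b + 1 - a) - b * (b - a)) * (w x)⁻¹ ^ 3))
      =O[atTop] fun x : ℝ => x⁻¹ ^ 4 := by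
  have h0 (b : ℝ) : (fun x => scaledIncGamma a (b + w x) - 0) =O[atTop]
      fun x : ℝ => x⁻¹ ^ 0 := by
    simpa only [sub_zero] using isBigO_one_scaledIncGamma ha b hre
  have h1 (b : ℝ) : (fun x => scaledIncGamma a (b + w x) - 0) =O[atTop]
      fun x : ℝ => x⁻¹ ^ 1 := by
    have hE : (fun x => -((Real.exp (-a) : ℝ) : ℂ) * (w x)⁻¹) =O[atTop] fun x : ℝ => x⁻¹ ^ 1 :=
      (Asymptotics.IsBigO.of_bound 1 (Eventually.of_forall fun x => by simp [hw])).const_mul_left _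
    refine ((scaledIncGamma_expansion_succ ha hw h0 b).add hE).congr_left fun x => ?_
    ring
  have h2 := scaledIncGamma_expansion_succ ha hw h1
  have h3 := scaledIncGamma_expansion_succ ha hw h2
  refine (scaledIncGamma_expansion_succ ha hw h3 b).congr_left fun x => ?_
  push_cast
  ring

theorem stmt_9 (a b : ℝ) (ha : 0 < a) :
    (fun x : ℝ => hypGamma (x : ℂ) a b - ((2 * (a - b) / Real.exp a : ℝ) : ℂ) / (x : ℂ) ^ 2)
      =O[atTop] fun x : ℝ => x⁻¹ ^ 4 := by
  have hpos := scaledIncGamma_expansion ha b (w := fun x : ℝ => Complex.I * x)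
    (fun x => by simp) (fun x => by simp)
  have hneg := scaledIncGamma_expansion ha b (w := fun x : ℝ => -(Complex.I * x))
    (fun x => by simp) (fun x => by simp)
  refine (hpos.add hneg).congr_left fun x => ?_
  have hE : ((2 * (a - b) / Real.exp a : ℝ) : ℂ) = 2 * (a - b) * (Real.exp (-a) : ℝ) := by
    rw [Real.exp_neg]
    push_cast
    ring
  have hI : (Complex.I * (x : ℂ))⁻¹ ^ 2 = -(x : ℂ)⁻¹ ^ 2 := by
    rw [mul_inv, mul_pow, inv_pow, Complex.I_sq]
    ring
  rw [hE]
  simp only [hypGamma, scaledIncGamma, inv_neg, ← sub_eq_add_neg]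
  linear_combination (-2 * (b - a) * (Real.exp (-a) : ℝ) : ℂ) * hI
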